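/- For any integer N ≥ 3 and any constant 0 < β < N−2, there exists a constant C > 0 such that for all y ∈ ℝ^N: ∫_{ℝ^N} |y−z|^{−(N−2)} (1+|z|)^{−(2+β)} dz ≤ C (1+|y|)^{−β}. -/

import Mathlib

open Real MeasureTheory

/-- The radial profile dominating the rescaled integrand. -/
noncomputable def profF (s a t : ℝ) : ℝ := if t ≤ 1 then t ^ (-s) + t ^ (-a) else t ^ (-s - a)

lemma profF_nonneg (s a t : ℝ) (ht : 0 ≤ t) : 0 ≤ profF s a t := by
  unfold profF
  split_ifs <;> positivity

lemma profF_integrable (N : ℕ) (hN : 3 ≤ N) (s a : ℝ) (hs : s < N) (ha : a < N) (hsa : N < s + a) :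
    Integrable (fun w : EuclideanSpace ℝ (Fin N) => profF s a ‖w‖) := by
  haveI : Nonempty (Fin N) := ⟨⟨0, by omega⟩⟩
  rw [integrable_fun_norm_addHaar (μ := volume) (f := profF s a)]
  rw [finrank_euclideanSpace_fin]
  have hc : ((N - 1 : ℕ) : ℝ) = N - 1 := by
    rw [Nat.cast_sub (by omega)]; simp
  have e : ∀ t : ℝ, 0 < t → ∀ p : ℝ, t ^ (N - 1) * t ^ p = t ^ ((N:ℝ) - 1 + p) := by
    intro t ht p
    rw [Real.rpow_add ht, ← hc, Real.rpow_natCast]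
  rw [← Set.Ioc_union_Ioi_eq_Ioi (zero_le_one' ℝ)]
  refine IntegrableOn.union ?_ ?_
  · have h1 : ∀ p : ℝ, p < N → IntegrableOn (fun t : ℝ => t ^ ((N:ℝ) - 1 + -p)) (Set.Ioc 0 1) := by
      intro p hp
      have := intervalIntegral.intervalIntegrable_rpow' (a := 0) (b := 1)
        (r := (N:ℝ) - 1 + -p) (by linarith)
      exact (intervalIntegrable_iff_integrableOn_Ioc_of_le zero_le_one).1 this
    refine ((h1 s hs).add (h1 a ha)).congr_fun ?_ measurableSet_Ioc
    intro t ht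
    simp only [Pi.add_apply, smul_eq_mul, profF, if_pos ht.2, mul_add, e t ht.1]
  · have h1 : IntegrableOn (fun t : ℝ => t ^ ((N:ℝ) - 1 + (-s - a))) (Set.Ioi 1) :=
      integrableOn_Ioi_rpow_of_lt (by linarith) one_pos
    refine h1.congr_fun ?_ measurableSet_Ioi
    intro t ht
    have ht' : (1:ℝ) < t := ht
    simp only [smul_eq_mul, profF, if_neg (not_le.2 ht')]
    rw [e t (by linarith)]

/-- Pointwise bound in terms of `R = 1 + |y|`, `d = |y - z|`, `r = |z|`. -/
lemma pointwise_bound (s a R d r : ℝ) (hs : 0 < s) (ha : 0 < a) (hR : 1 ≤ R) (hd : 0 ≤ d)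
    (hr : 0 < r) (h1 : R ≤ 1 + r + d) (h2 : r ≤ R + d) :
    d ^ (-s) * (1 + r) ^ (-a) ≤
      (2 ^ a + 3 ^ s) * R ^ (-s - a) * (profF s a (R⁻¹ * d) + profF s a (R⁻¹ * r)) := by
  have hR0 : 0 < R := by linarith
  have hRi : 0 < R⁻¹ := inv_pos.2 hR0
  have key : ∀ p t : ℝ, 0 ≤ t → R ^ (-p) * (R⁻¹ * t) ^ (-p) = t ^ (-p) := by
    intro p t ht
    rw [← Real.mul_rpow hR0.le (by positivity), mul_inv_cancel_left₀ hR0.ne']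
  have sc : ∀ c p : ℝ, 0 < c → ∀ t, 0 ≤ t → (t / c) ^ (-p) = c ^ p * t ^ (-p) := by
    intro c p hc t ht
    rw [Real.div_rpow ht hc.le, Real.rpow_neg hc.le, div_inv_eq_mul, mul_comm]
  have hsum : R ^ (-s - a) = R ^ (-s) * R ^ (-a) := by
    rw [← Real.rpow_add hR0]; ring_nf
  have n1 := profF_nonneg s a (R⁻¹ * d) (by positivity)
  have n2 := profF_nonneg s a (R⁻¹ * r) (by positivity)
  have p2 : (0:ℝ) < 2 ^ a := by positivity
  have p3 : (0:ℝ) < 3 ^ s := by positivity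
  by_cases hA : d ≤ R / 2
  · have b : (1 + r) ^ (-a) ≤ 2 ^ a * R ^ (-a) := by
      rw [← sc 2 a two_pos R hR0.le]
      exact Real.rpow_le_rpow_of_nonpos (by positivity) (by linarith) (by linarith)
    have f1 : (R⁻¹ * d) ^ (-s) ≤ profF s a (R⁻¹ * d) := by
      have : R⁻¹ * d ≤ 1 := by
        rw [inv_mul_le_iff₀ hR0]; linarith
      rw [profF, if_pos this]
      have : 0 ≤ (R⁻¹ * d) ^ (-a) := by positivity
      linarith
    calc d ^ (-s) * (1 + r) ^ (-a) ≤ d ^ (-s) * (2 ^ a * R ^ (-a)) := by gcongr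
      _ = 2 ^ a * R ^ (-s - a) * ((R⁻¹ * d) ^ (-s)) := by
        rw [← key s d hd, hsum]; ring
      _ ≤ _ := by
        gcongr
        · linarith
        · linarith
  · push Not at hA
    have hdp : 0 < d := by linarith
    have b : (1 + r) ^ (-a) ≤ r ^ (-a) :=
      Real.rpow_le_rpow_of_nonpos hr (by linarith) (by linarith)
    by_cases hB : R⁻¹ * r ≤ 1
    · have b2 : d ^ (-s) ≤ 3 ^ s * R ^ (-s) := by
        rw [← sc 3 s three_pos R hR0.le]
        exact Real.rpow_le_rpow_of_nonpos (by positivity) (by linarith) (by linarith)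
      have f1 : (R⁻¹ * r) ^ (-a) ≤ profF s a (R⁻¹ * r) := by
        rw [profF, if_pos hB]
        have : 0 ≤ (R⁻¹ * r) ^ (-s) := by positivity
        linarith
      calc d ^ (-s) * (1 + r) ^ (-a) ≤ (3 ^ s * R ^ (-s)) * r ^ (-a) := by gcongr
        _ = 3 ^ s * R ^ (-s - a) * ((R⁻¹ * r) ^ (-a)) := by
          rw [← key a r hr.le, hsum]; ring
        _ ≤ _ := by
          gcongr
          · linarith
          · linarith
    · have b2 : d ^ (-s) ≤ 3 ^ s * r ^ (-s) := by
        rw [← sc 3 s three_pos r hr.le]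
        exact Real.rpow_le_rpow_of_nonpos (by positivity) (by linarith) (by linarith)
      have f1 : (R⁻¹ * r) ^ (-s - a) ≤ profF s a (R⁻¹ * r) := by
        rw [profF, if_neg hB]
      calc d ^ (-s) * (1 + r) ^ (-a) ≤ (3 ^ s * r ^ (-s)) * r ^ (-a) := by gcongr
        _ = 3 ^ s * R ^ (-s - a) * ((R⁻¹ * r) ^ (-s - a)) := by
          have := key (s + a) r hr.le
          rw [show -(s + a) = -s - a by ring] at this
          rw [mul_assoc, mul_assoc, this, ← Real.rpow_add hr]; ring_nf
        _ ≤ _ := by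
          gcongr
          · linarith
          · linarith

theorem stmt_1 (N : ℕ) (hN : 3 ≤ N) (β : ℝ) (hβ0 : 0 < β) (hβ : β < N - 2) :
    ∃ C > 0, ∀ y : EuclideanSpace ℝ (Fin N),
      (∫ z : EuclideanSpace ℝ (Fin N),
          ‖y - z‖ ^ (-(N - 2 : ℝ)) * (1 + ‖z‖) ^ (-(2 + β))) ≤
        C * (1 + ‖y‖) ^ (-β) := by
  haveI : Nonempty (Fin N) := ⟨⟨0, by omega⟩⟩
  set s : ℝ := N - 2 with hs
  set a : ℝ := 2 + β with ha
  have hs0 : 0 < s := by linarith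
  have ha0 : 0 < a := by linarith
  set G : EuclideanSpace ℝ (Fin N) → ℝ := fun w => profF s a ‖w‖ with hG
  have hGi : Integrable G := profF_integrable N hN s a (by linarith) (by linarith) (by linarith)
  have hG0 : 0 ≤ ∫ w, G w := integral_nonneg fun w => profF_nonneg _ _ _ (norm_nonneg _)
  set I := ∫ w, G w with hI
  refine ⟨(2 ^ a + 3 ^ s) * (2 * I) + 1, by positivity, fun y => ?_⟩
  set R := 1 + ‖y‖ with hR
  have hR1 : 1 ≤ R := by have := norm_nonneg y; linarith
  have hR0 : 0 < R := by linarith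
  have hRi : R⁻¹ ≠ 0 := inv_ne_zero hR0.ne'
  have i2 : Integrable (fun z => G (R⁻¹ • z)) := hGi.comp_smul hRi
  have i1 : Integrable (fun z => G (R⁻¹ • (y - z))) := i2.comp_sub_left y
  have e2 : ∫ z, G (R⁻¹ • z) = R ^ (N:ℝ) * I := by
    rw [Measure.integral_comp_smul, finrank_euclideanSpace_fin, smul_eq_mul, inv_pow, inv_inv,
      abs_of_pos (by positivity), Real.rpow_natCast]
  have e1 : ∫ z, G (R⁻¹ • (y - z)) = R ^ (N:ℝ) * I := by
    rw [← e2]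
    exact integral_sub_left_eq_self (fun z => G (R⁻¹ • z)) volume y
  have hb : (∫ z : EuclideanSpace ℝ (Fin N), ‖y - z‖ ^ (-s) * (1 + ‖z‖) ^ (-a)) ≤
      ∫ z, (2 ^ a + 3 ^ s) * R ^ (-s - a) * (G (R⁻¹ • (y - z)) + G (R⁻¹ • z)) := by
    refine integral_mono_of_nonneg (Filter.Eventually.of_forall fun z => by positivity)
      ((i1.add i2).const_mul _) ?_
    filter_upwards [Measure.ae_ne volume (0 : EuclideanSpace ℝ (Fin N))] with z hz
    have hab : ‖R⁻¹‖ = R⁻¹ := by rw [Real.norm_eq_abs, abs_of_pos (by positivity)]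
    simp only [hG, norm_smul, hab]
    refine pointwise_bound s a R ‖y - z‖ ‖z‖ hs0 ha0 hR1 (norm_nonneg _) (norm_pos_iff.2 hz) ?_ ?_
    · have := norm_add_le z (y - z)
      rw [add_sub_cancel] at this
      linarith
    · have := norm_sub_le y (y - z)
      rw [sub_sub_cancel] at this
      linarith
  refine hb.trans ?_
  rw [integral_const_mul, integral_add i1 i2, e1, e2]
  have : R ^ (-s - a) * R ^ (N:ℝ) = R ^ (-β) := by
    rw [← Real.rpow_add hR0, hs, ha]; ring_nf
  have hp : 0 ≤ R ^ (-β) := by positivity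
  calc _ = (2 ^ a + 3 ^ s) * (2 * I) * (R ^ (-s - a) * R ^ (N:ℝ)) := by ring
    _ = (2 ^ a + 3 ^ s) * (2 * I) * R ^ (-β) := by rw [this]
    _ ≤ _ := by linarith
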